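/- arXiv:2211.02513 — 6 statements merged into one kernel-verified Lean document; each statement's English description precedes it below -/
import Mathlib

section
/- For every integer k ≥ 1 there exists a stable Serial Knockout Competition on 2^k players; that is, there exists a family of 2^k − 1 seedings s_1, …, s_{2^k−1} : Fin (2^k) ≃ Fin (2^k) such that for every i with 1 ≤ i ≤ k and every pair of distinct players x, y ∈ Fin (2^k), the number of indices j with v_{s_j}(x, y) = i equals 2^{i−1}. -/
/-- Under seeding `s` (a bijection from players to leaf positions of a balanced
binary knockout tree with `k` rounds), two distinct players `x`, `y` can meet in round
`meetRound k s x y`, the least `i ≥ 1` with `⌊s x / 2^i⌋ = ⌊s y / 2^i⌋`. -/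
noncomputable def meetRound {α : Type*} (k : ℕ) (s : α ≃ Fin (2 ^ k)) (x y : α) : ℕ :=
  sInf {i | 1 ≤ i ∧ (s x : ℕ) / 2 ^ i = (s y : ℕ) / 2 ^ i}

/-- For distinct players, the meeting round is `i + 1` exactly when the leaf positions first
agree after deleting their last `i + 1` binary digits. -/
theorem meetRound_eq_succ_iff {α : Type*} {k : ℕ} (s : α ≃ Fin (2 ^ k)) {x y : α} (hxy : x ≠ y)
    (i : ℕ) :
    meetRound k s x y = i + 1 ↔
      (s x : ℕ) / 2 ^ (i + 1) = (s y : ℕ) / 2 ^ (i + 1) ∧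
        (s x : ℕ) / 2 ^ i ≠ (s y : ℕ) / 2 ^ i := by
  have hne : (s x : ℕ) ≠ s y := fun h => hxy (s.injective (Fin.ext h))
  have hmono : ∀ {m n : ℕ}, m ≤ n → (s x : ℕ) / 2 ^ m = (s y : ℕ) / 2 ^ m →
      (s x : ℕ) / 2 ^ n = (s y : ℕ) / 2 ^ n := by
    intro m n hmn h
    obtain ⟨c, rfl⟩ := Nat.exists_eq_add_of_le hmn
    rw [pow_add, ← Nat.div_div_eq_div_mul, ← Nat.div_div_eq_div_mul, h]
  constructor
  · intro h
    have hpos : 0 < meetRound k s x y := h ▸ i.succ_pos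
    have hmem := Nat.sInf_mem (Nat.nonempty_of_pos_sInf hpos)
    change meetRound k s x y ∈ _ at hmem
    rw [h] at hmem
    refine ⟨hmem.2, fun hi => ?_⟩
    rcases i.eq_zero_or_pos with rfl | hpos
    · exact hne (by simpa using hi)
    · have hle : meetRound k s x y ≤ i := Nat.sInf_le ⟨hpos, hi⟩
      omega
  · rintro ⟨h₁, h₂⟩
    refine IsLeast.csInf_eq ⟨⟨by omega, h₁⟩, fun j hj => ?_⟩
    by_contra! hlt
    exact h₂ (hmono (Nat.le_of_lt_succ hlt) hj.2)

theorem Nat.div_two_pow_eq_iff_testBit (m n i : ℕ) :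
    m / 2 ^ i = n / 2 ^ i ↔ ∀ j, i ≤ j → m.testBit j = n.testBit j := by
  constructor
  · intro h j hj
    obtain ⟨c, rfl⟩ := Nat.exists_eq_add_of_le hj
    simpa [Nat.testBit_div_two_pow, add_comm] using congrArg (fun t => t.testBit c) h
  · intro h
    refine Nat.eq_of_testBit_eq fun c => ?_
    simpa [Nat.testBit_div_two_pow, add_comm] using h (i + c) (by omega)

/-- Vectors over `𝔽₂` are numbered by their binary expansions, so that two of them agree after
deleting the last `i` digits exactly when their difference is numbered below `2 ^ i`. -/
theorem exists_binary_equiv (k : ℕ) :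
    ∃ e : (Fin k → ZMod 2) ≃ Fin (2 ^ k), ∀ (v w : Fin k → ZMod 2) (i : ℕ),
      (e v : ℕ) / 2 ^ i = (e w : ℕ) / 2 ^ i ↔ (e (v - w) : ℕ) < 2 ^ i := by
  let e : (Fin k → ZMod 2) ≃ Fin (2 ^ k) := finFunctionFinEquiv
  have hbit (v : Fin k → ZMod 2) (j : Fin k) :
      (e v : ℕ).testBit j = decide (v j = 1) := by
    have h : (v j : ZMod 2) = (e.symm (e v)) j := by rw [e.symm_apply_apply]
    have hval : (v j).val = (e v : ℕ) / 2 ^ (j : ℕ) % 2 := by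
      rw [h]; rfl
    rw [Nat.testBit_eq_decide_div_mod_eq, ← hval]
    generalize v j = a
    revert a
    decide
  have hdiv (v w : Fin k → ZMod 2) (i : ℕ) :
      (e v : ℕ) / 2 ^ i = (e w : ℕ) / 2 ^ i ↔ ∀ j : Fin k, i ≤ j → v j = w j := by
    rw [Nat.div_two_pow_eq_iff_testBit]
    have hdec : ∀ a b : ZMod 2, decide (a = 1) = decide (b = 1) ↔ a = b := by decide
    constructor
    · intro h j hj
      simpa only [hbit, hdec] using h j hj
    · intro h j hj
      by_cases hjk : j < k
      · simpa only [hbit, hdec] using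
          (hbit v ⟨j, hjk⟩).trans ((by rw [h ⟨j, hjk⟩ hj] : _ = _).trans (hbit w ⟨j, hjk⟩).symm)
      · have hle : 2 ^ k ≤ 2 ^ j := Nat.pow_le_pow_right two_pos (not_lt.mp hjk)
        rw [Nat.testBit_lt_two_pow ((e v).isLt.trans_le hle),
          Nat.testBit_lt_two_pow ((e w).isLt.trans_le hle)]
  have hzero : (e 0 : ℕ) = 0 := by
    refine Nat.eq_of_testBit_eq fun j => ?_
    by_cases hjk : j < k
    · simpa using hbit 0 ⟨j, hjk⟩
    · rw [Nat.testBit_lt_two_pow ((e 0).isLt.trans_le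
        (Nat.pow_le_pow_right two_pos (not_lt.mp hjk))), Nat.zero_testBit]
  refine ⟨e, fun v w i => ?_⟩
  have h := hdiv (v - w) 0 i
  rw [hzero, Nat.zero_div, Nat.div_eq_zero_iff_lt (by positivity)] at h
  rw [hdiv, h]
  simp [sub_eq_zero]

/-- For every `k ≥ 1` there is a stable Serial Knockout Competition on `2^k` players:
a family of `2^k - 1` seedings such that for each round `1 ≤ i ≤ k` and each pair of
distinct players `x, y`, exactly `2^(i-1)` of the seedings have the pair meeting in round `i`. -/
theorem exists_stable_SKC (k : ℕ) (hk : 1 ≤ k) :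
    ∃ s : Fin (2 ^ k - 1) → (Fin (2 ^ k) ≃ Fin (2 ^ k)),
      ∀ i : ℕ, 1 ≤ i → i ≤ k → ∀ x y : Fin (2 ^ k), x ≠ y →
        (Finset.univ.filter fun j : Fin (2 ^ k - 1) =>
          meetRound k (s j) x y = i).card = 2 ^ (i - 1) := by
  classical
  let F := GaloisField 2 k
  have hrank : Module.finrank (ZMod 2) F = k := GaloisField.finrank 2 (by omega)
  let b : F ≃ₗ[ZMod 2] (Fin k → ZMod 2) :=
    (Module.finBasisOfFinrankEq (ZMod 2) F hrank).equivFun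
  obtain ⟨e₀, he₀⟩ := exists_binary_equiv k
  let e : F ≃ Fin (2 ^ k) := b.toEquiv.trans e₀
  have he (a c : F) (i : ℕ) :
      (e a : ℕ) / 2 ^ i = (e c : ℕ) / 2 ^ i ↔ (e (a - c) : ℕ) < 2 ^ i := by
    have h := he₀ (b a) (b c) i
    rwa [← map_sub] at h
  have he_zero : (e 0 : ℕ) = 0 := by simpa using he 0 0 0
  have : Fintype F := Fintype.ofEquiv _ e.symm
  have hcard : Fintype.card Fˣ = 2 ^ k - 1 := by
    rw [Fintype.card_units, Fintype.card_congr e, Fintype.card_fin]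
  let u : Fˣ ≃ Fin (2 ^ k - 1) := Fintype.equivFinOfCardEq hcard
  refine ⟨fun j => e.symm.trans ((u.symm j).mulLeft.trans e), fun i hi hik x y hxy => ?_⟩
  obtain ⟨i, rfl⟩ := Nat.exists_eq_add_of_le' hi
  let d : F := e.symm x - e.symm y
  have hd : d ≠ 0 := sub_ne_zero.mpr (e.symm.injective.ne hxy)
  have hmeet (j : Fin (2 ^ k - 1)) :
      meetRound k (e.symm.trans ((u.symm j).mulLeft.trans e)) x y = i + 1 ↔
        (e (u.symm j * d) : ℕ) ∈ Finset.Ico (2 ^ i) (2 ^ (i + 1)) := by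
    rw [meetRound_eq_succ_iff _ hxy, Finset.mem_Ico]
    simp only [Equiv.trans_apply, Units.mulLeft_apply, ne_eq, he, ← mul_sub, not_lt]
    exact and_comm
  simp only [hmeet, Nat.add_sub_cancel]
  have hIco : (Finset.Ico (2 ^ i) (2 ^ (i + 1))).card = 2 ^ i := by
    rw [Nat.card_Ico, pow_succ]; omega
  refine Eq.trans (Finset.card_bij (fun j _ => (e (u.symm j * d) : ℕ)) ?_ ?_ ?_) hIco
  · intro j hj
    exact (Finset.mem_filter.mp hj).2
  · intro j _ j' _ h
    exact u.symm.injective (Units.ext (mul_right_cancel₀ hd (e.injective (Fin.ext h))))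
  · intro n hn
    have hn' := Finset.mem_Ico.mp hn
    have hnk : n < 2 ^ k := hn'.2.trans_le (Nat.pow_le_pow_right two_pos hik)
    let a : F := e.symm ⟨n, hnk⟩
    have hea : (e a : ℕ) = n := by simp [a]
    have ha : a ≠ 0 := by
      intro h
      have hpos : 0 < 2 ^ i := by positivity
      rw [h, he_zero] at hea
      omega
    have hval : (e (u.symm (u (Units.mk0 (a / d) (div_ne_zero ha hd))) * d) : ℕ) = n := by
      rw [u.symm_apply_apply, Units.val_mk0, div_mul_cancel₀ _ hd, hea]
    exact ⟨_, Finset.mem_filter.mpr ⟨Finset.mem_univ _, hval.symm ▸ hn⟩, hval⟩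
end

section
/- Let k ≥ 1 and let a, b ∈ Fin (2^k) be distinct. Then the least i ≥ 1 such that ⌊a/2^i⌋ = ⌊b/2^i⌋ equals 1 + ⌊log₂(a XOR b)⌋, where XOR denotes bitwise exclusive or of the natural numbers a and b. In other words, under the identity seeding on Fin (2^k), two distinct players a and b meet exactly at round one plus the index of the highest bit in which a and b differ. -/
theorem Nat.div_two_pow_eq_iff_log_xor_lt {m n : ℕ} (h : m ≠ n) (i : ℕ) :
    m / 2 ^ i = n / 2 ^ i ↔ Nat.log 2 (m ^^^ n) < i := by
  rw [Nat.log_lt_iff_lt_pow one_lt_two (Nat.xor_ne_zero_iff.2 h), ← Nat.xor_eq_zero_iff,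
    ← Nat.xor_div_two_pow, Nat.div_eq_zero_iff_lt (by positivity)]

/-- Under the identity seeding on `Fin (2^k)`, two distinct players `a` and `b` meet
exactly in round `1 + Nat.log 2 (a XOR b)`, i.e. one plus the index of the highest
bit in which `a` and `b` differ. -/
theorem meetRound_id_eq_one_add_log_xor (k : ℕ) (hk : 1 ≤ k)
    (a b : Fin (2 ^ k)) (hab : a ≠ b) :
    meetRound k (Equiv.refl (Fin (2 ^ k))) a b = 1 + Nat.log 2 ((a : ℕ) ^^^ (b : ℕ)) := by
  have hset : {i | 1 ≤ i ∧ (a : ℕ) / 2 ^ i = (b : ℕ) / 2 ^ i} =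
      Set.Ici (1 + Nat.log 2 ((a : ℕ) ^^^ (b : ℕ))) := by
    ext i
    simp only [Set.mem_ofPred_eq, Set.mem_Ici,
      Nat.div_two_pow_eq_iff_log_xor_lt (Fin.val_ne_of_ne hab)]
    omega
  simp only [meetRound, Equiv.refl_apply, hset, csInf_Ici]
end

section
/- Let k ≥ 1, let 𝒯 be a family of 2^k − 1 seedings on Fin (2^k), let 1 ≤ i ≤ k, and suppose 𝒯 is stable in round i with some constant c (i.e., for every pair of distinct players x, y, the number of seedings s ∈ 𝒯 with v_s(x, y) = i equals c). Then c = 2^{i−1}. -/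
theorem meetRound_eq_iff {α : Type*} {k : ℕ} (s : α ≃ Fin (2 ^ k)) {x y : α} (hxy : x ≠ y)
    {i : ℕ} (h1 : 1 ≤ i) :
    meetRound k s x y = i ↔
      (s x : ℕ) / 2 ^ i = (s y : ℕ) / 2 ^ i ∧
        (s x : ℕ) / 2 ^ (i - 1) ≠ (s y : ℕ) / 2 ^ (i - 1) := by
  have mono : ∀ {a b m n : ℕ}, m ≤ n → a / 2 ^ m = b / 2 ^ m → a / 2 ^ n = b / 2 ^ n := by
    intro a b m n hmn h
    obtain ⟨d, rfl⟩ := Nat.exists_eq_add_of_le hmn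
    rw [pow_add, ← Nat.div_div_eq_div_mul, ← Nat.div_div_eq_div_mul, h]
  have hne : (s x : ℕ) ≠ s y := fun h => hxy (s.injective (Fin.ext h))
  constructor
  · intro h
    have hmem : i ∈ {i | 1 ≤ i ∧ (s x : ℕ) / 2 ^ i = (s y : ℕ) / 2 ^ i} := by
      rw [← h]
      apply Nat.sInf_mem
      exact Nat.nonempty_of_pos_sInf (by change 0 < meetRound k s x y; omega)
    refine ⟨hmem.2, fun h' => ?_⟩
    by_cases hi : i = 1
    · subst hi
      exact hne (by simpa using h')
    · have : meetRound k s x y ≤ i - 1 := Nat.sInf_le ⟨by omega, h'⟩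
      omega
  · rintro ⟨h, h'⟩
    refine le_antisymm (Nat.sInf_le ⟨h1, h⟩) (le_csInf ⟨i, h1, h⟩ ?_)
    rintro n ⟨-, hn⟩
    by_contra! hlt
    exact h' (mono (by omega) hn)

theorem card_filter_div_two_pow_eq {k i : ℕ} (hi : i ≤ k) (a : Fin (2 ^ k)) :
    (Finset.univ.filter fun b : Fin (2 ^ k) =>
      (a : ℕ) / 2 ^ i = (b : ℕ) / 2 ^ i).card = 2 ^ i := by
  have hpos : 0 < 2 ^ i := by positivity
  have hblock : ((a : ℕ) / 2 ^ i + 1) * 2 ^ i ≤ 2 ^ k := by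
    have hk : 2 ^ k = 2 ^ (k - i) * 2 ^ i := by rw [← pow_add]; congr 1; omega
    have hq : (a : ℕ) / 2 ^ i < 2 ^ (k - i) :=
      (Nat.div_lt_iff_lt_mul hpos).2 (a.isLt.trans_eq hk)
    exact (Nat.mul_le_mul_right _ hq).trans_eq hk.symm
  rw [← Finset.card_map Fin.valEmbedding]
  have : (Finset.univ.filter fun b : Fin (2 ^ k) =>
      (a : ℕ) / 2 ^ i = (b : ℕ) / 2 ^ i).map Fin.valEmbedding =
      Finset.Ico ((a : ℕ) / 2 ^ i * 2 ^ i) (((a : ℕ) / 2 ^ i + 1) * 2 ^ i) := by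
    ext n
    simp only [Finset.mem_map, Finset.mem_filter, Finset.mem_univ, true_and,
      Fin.valEmbedding_apply, Finset.mem_Ico]
    rw [← Nat.le_div_iff_mul_le hpos, ← Nat.div_lt_iff_lt_mul hpos]
    constructor
    · rintro ⟨b, hb, rfl⟩
      omega
    · rintro ⟨hl, hu⟩
      have hn : n < 2 ^ k := ((Nat.div_lt_iff_lt_mul hpos).1 hu).trans_le hblock
      exact ⟨⟨n, hn⟩, by simp only; omega, rfl⟩
  rw [this, Nat.card_Ico, add_mul, one_mul, Nat.add_sub_cancel_left]

theorem card_filter_meetRound_eq {α : Type*} [Fintype α] [DecidableEq α] {k : ℕ}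
    (s : α ≃ Fin (2 ^ k)) (x : α) {i : ℕ} (h1 : 1 ≤ i) (h2 : i ≤ k) :
    ((Finset.univ.erase x).filter fun y => meetRound k s x y = i).card = 2 ^ (i - 1) := by
  set A := Finset.univ.filter fun b : Fin (2 ^ k) => (s x : ℕ) / 2 ^ i = (b : ℕ) / 2 ^ i
  set B := Finset.univ.filter fun b : Fin (2 ^ k) =>
    (s x : ℕ) / 2 ^ (i - 1) = (b : ℕ) / 2 ^ (i - 1)
  have hpow : 2 ^ i = 2 ^ (i - 1) * 2 := by rw [← pow_succ]; congr 1; omega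
  have hBA : B ⊆ A := by
    intro b hb
    simp only [A, B, Finset.mem_filter, Finset.mem_univ, true_and] at hb ⊢
    rw [hpow, ← Nat.div_div_eq_div_mul, ← Nat.div_div_eq_div_mul, hb]
  have hcard : ((Finset.univ.erase x).filter fun y => meetRound k s x y = i).card =
      (A \ B).card := by
    refine Finset.card_equiv s fun y => ?_
    simp only [A, B, Finset.mem_filter, Finset.mem_erase, Finset.mem_sdiff, Finset.mem_univ,
      true_and, and_true]
    by_cases hxy : y = x
    · simp [hxy]
    · simp [hxy, meetRound_eq_iff s (Ne.symm hxy) h1]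
  rw [hcard, Finset.card_sdiff_of_subset hBA, card_filter_div_two_pow_eq h2,
    card_filter_div_two_pow_eq (by omega), hpow]
  omega

/-- If a family of `2^k - 1` seedings is stable in round `i` (with `1 ≤ i ≤ k`) with
some constant `c`, then necessarily `c = 2^(i-1)`. -/
theorem stable_constant_eq (k : ℕ) (hk : 1 ≤ k)
    (T : Fin (2 ^ k - 1) → (Fin (2 ^ k) ≃ Fin (2 ^ k)))
    (i : ℕ) (h1 : 1 ≤ i) (h2 : i ≤ k) (c : ℕ)
    (hT : ∀ x y : Fin (2 ^ k), x ≠ y →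
      (Finset.univ.filter fun j : Fin (2 ^ k - 1) =>
        meetRound k (T j) x y = i).card = c) :
    c = 2 ^ (i - 1) := by
  let x : Fin (2 ^ k) := ⟨0, by positivity⟩
  have hcount := Finset.sum_card_bipartiteAbove_eq_sum_card_bipartiteBelow
    (s := Finset.univ.erase x) (t := (Finset.univ : Finset (Fin (2 ^ k - 1))))
    (fun y j => meetRound k (T j) x y = i)
  have hl : ∀ y ∈ Finset.univ.erase x, (Finset.bipartiteAbove
      (fun y j => meetRound k (T j) x y = i) Finset.univ y).card = c :=
    fun y hy => hT x y (Finset.ne_of_mem_erase hy).symm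
  have hr : ∀ j ∈ (Finset.univ : Finset (Fin (2 ^ k - 1))), (Finset.bipartiteBelow
      (fun y j => meetRound k (T j) x y = i) (Finset.univ.erase x) j).card = 2 ^ (i - 1) :=
    fun j _ => card_filter_meetRound_eq (T j) x h1 h2
  rw [Finset.sum_congr rfl hl, Finset.sum_congr rfl hr] at hcount
  simp only [Finset.sum_const, Finset.card_erase_of_mem (Finset.mem_univ x), Finset.card_univ,
    Fintype.card_fin, smul_eq_mul] at hcount
  have hpos : 0 < 2 ^ k - 1 := Nat.sub_pos_of_lt (Nat.one_lt_two_pow (by omega))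
  exact Nat.eq_of_mul_eq_mul_left hpos hcount
end

section
/- The seven seedings of Fin 8 given (as lists of the images of positions 0,…,7) by (0,1,4,5,2,3,6,7), (0,4,2,6,1,5,3,7), (0,2,1,3,4,6,5,7), (0,3,5,6,1,2,4,7), (0,5,2,7,1,4,3,6), (0,7,3,4,1,6,2,5), (0,6,1,7,2,4,3,5) — i.e., the seedings 0145-2367, 0426-1537, 0213-4657, 0356-1247, 0527-1436, 0734-1625, 0617-2435 — form a stable Serial Knockout Competition on 8 players: for every i ∈ {1, 2, 3} and every pair of distinct players x, y ∈ Fin 8, exactly 2^{i−1} of these seven seedings s satisfy v_s(x, y) = i. -/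
/-- The seeding determined by the list `l` of players assigned, in order, to the
8 leaves of the knockout tree: it sends each player to its position in the list. -/
noncomputable def seedingOfList (l : Fin 8 → Fin 8) (h : Function.Bijective l) : Fin 8 ≃ Fin (2 ^ 3) :=
  (Equiv.ofBijective l h).symm

/-- The seven seedings 0145-2367, 0426-1537, 0213-4657, 0356-1247, 0527-1436,
0734-1625, 0617-2435 of Table 1. -/
noncomputable def T7 : Fin 7 → (Fin 8 ≃ Fin (2 ^ 3)) :=
  ![seedingOfList ![0, 1, 4, 5, 2, 3, 6, 7] (by decide),
    seedingOfList ![0, 4, 2, 6, 1, 5, 3, 7] (by decide),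
    seedingOfList ![0, 2, 1, 3, 4, 6, 5, 7] (by decide),
    seedingOfList ![0, 3, 5, 6, 1, 2, 4, 7] (by decide),
    seedingOfList ![0, 5, 2, 7, 1, 4, 3, 6] (by decide),
    seedingOfList ![0, 7, 3, 4, 1, 6, 2, 5] (by decide),
    seedingOfList ![0, 6, 1, 7, 2, 4, 3, 5] (by decide)]

/-- In an 8-leaf tree, two distinct players meet in round 1, 2 or 3, according to the first
of the halved and quartered leaf positions that agree. -/
theorem meetRound_three_eq {α : Type*} (s : α ≃ Fin (2 ^ 3)) (x y : α) :
    meetRound 3 s x y =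
      if (s x : ℕ) / 2 = (s y : ℕ) / 2 then 1
      else if (s x : ℕ) / 4 = (s y : ℕ) / 4 then 2 else 3 := by
  have hx : (s x : ℕ) < 8 := (s x).isLt
  have hy : (s y : ℕ) < 8 := (s y).isLt
  refine IsLeast.csInf_eq ⟨?_, ?_⟩
  · split_ifs with h₁ h₂
    · exact ⟨le_rfl, by simpa using h₁⟩
    · exact ⟨by norm_num, by simpa using h₂⟩
    · exact ⟨by norm_num, by omega⟩
  · rintro i ⟨hi, h⟩
    by_contra! hlt
    have hi2 : i = 1 ∨ i = 2 := by split_ifs at hlt <;> omega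
    rcases hi2 with rfl | rfl
    · simp_all
    · norm_num at h
      simp only [h, if_true] at hlt
      split_ifs at hlt <;> omega

/-- The leaf position of player `x` in the list `l`, in a form that evaluates. -/
def leafPosition (l : Fin 8 → Fin 8) (x : Fin 8) : ℕ :=
  ∑ p, if l p = x then (p : ℕ) else 0

theorem seedingOfList_val (l : Fin 8 → Fin 8) (h : Function.Bijective l) (x : Fin 8) :
    (seedingOfList l h x : ℕ) = leafPosition l x := by
  obtain ⟨p, rfl⟩ := h.2 x
  have hp : seedingOfList l h (l p) = p := (Equiv.ofBijective l h).symm_apply_apply p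
  rw [hp]
  simp [leafPosition, h.1.eq_iff]

/-- The lists of players defining the seedings `T7`. -/
def playerList : Fin 7 → Fin 8 → Fin 8 :=
  ![![0, 1, 4, 5, 2, 3, 6, 7], ![0, 4, 2, 6, 1, 5, 3, 7], ![0, 2, 1, 3, 4, 6, 5, 7],
    ![0, 3, 5, 6, 1, 2, 4, 7], ![0, 5, 2, 7, 1, 4, 3, 6], ![0, 7, 3, 4, 1, 6, 2, 5],
    ![0, 6, 1, 7, 2, 4, 3, 5]]

theorem T7_val (j : Fin 7) (x : Fin 8) : (T7 j x : ℕ) = leafPosition (playerList j) x := by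
  fin_cases j <;> exact seedingOfList_val _ _ x

/-- The seven seedings of Table 1 form a stable Serial Knockout Competition on
8 players: each pair of distinct players can meet in round `i` in exactly `2^(i-1)`
of the seven knockout tournaments, for `i = 1, 2, 3`. -/
theorem table1_stable :
    ∀ i : ℕ, 1 ≤ i → i ≤ 3 → ∀ x y : Fin 8, x ≠ y →
      (Finset.univ.filter fun j : Fin 7 =>
        meetRound 3 (T7 j) x y = i).card = 2 ^ (i - 1) := by
  intro i hi₁ hi₃
  simp only [meetRound_three_eq, T7_val]
  interval_cases i <;> decide +kernel
end

section
/- Let V = (ZMod 2)^3, let x ∈ V be nonzero, and let W be a two-dimensional linear subspace of V with x ∈ W. Then there exists a seeding s : V ≃ Fin 8 such that for all distinct a, b ∈ V: v_s(a, b) = 1 if a + b = x; v_s(a, b) = 2 if a + b ∈ W and a + b ∉ {0, x}; and v_s(a, b) = 3 if a + b ∉ W. In particular v_s(a, b) = v_s(0, a + b) for all distinct a, b ∈ V. -/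
/-- The meeting round is determined by the coordinates of the players in the binary
expansion of their leaf positions. -/
theorem meetRound_binary {α : Type*} (c : α ≃ (Fin 3 → ZMod 2)) (a b : α) :
    meetRound 3 (c.trans (finFunctionFinEquiv (m := 2) (n := 3))) a b =
      if c a 2 ≠ c b 2 then 3 else if c a 1 ≠ c b 1 then 2 else 1 := by
  have key : ∀ u v : Fin 3 → Fin 2,
      ((finFunctionFinEquiv u : ℕ) / 2 ^ 1 = (finFunctionFinEquiv v : ℕ) / 2 ^ 1 ↔
        u 2 = v 2 ∧ u 1 = v 1) ∧
      ((finFunctionFinEquiv u : ℕ) / 2 ^ 2 = (finFunctionFinEquiv v : ℕ) / 2 ^ 2 ↔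
        u 2 = v 2) ∧
      (finFunctionFinEquiv u : ℕ) / 2 ^ 3 = (finFunctionFinEquiv v : ℕ) / 2 ^ 3 := by
    intro u v
    simp only [finFunctionFinEquiv_apply, Fin.sum_univ_three, Fin.ext_iff]
    have := (u 0).isLt
    have := (u 1).isLt
    have := (u 2).isLt
    have := (v 0).isLt
    have := (v 1).isLt
    have := (v 2).isLt
    norm_num
    omega
  obtain ⟨h₁, h₂, h₃⟩ := key (c a) (c b)
  have least : ∀ (S : Set ℕ) (n : ℕ), n ∈ S → (∀ i ∈ S, n ≤ i) → sInf S = n :=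
    fun S n hn hS => IsLeast.csInf_eq ⟨hn, hS⟩
  unfold meetRound
  apply least
  · rw [Set.mem_ofPred_eq]
    split_ifs with h h'
    · exact ⟨by norm_num, h₃⟩
    · exact ⟨by norm_num, h₂.2 (not_not.1 h)⟩
    · exact ⟨le_rfl, h₁.2 ⟨not_not.1 h, not_not.1 h'⟩⟩
  · rintro i ⟨hi, he⟩
    change (finFunctionFinEquiv (m := 2) (c a) : ℕ) / 2 ^ i =
      (finFunctionFinEquiv (m := 2) (c b) : ℕ) / 2 ^ i at he
    split_ifs with h h'
    · by_contra! hlt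
      interval_cases i
      · exact h (h₁.1 he).1
      · exact h (h₂.1 he)
    · by_contra! hlt
      interval_cases i
      exact h' (h₁.1 he).2
    · exact hi

/-- A full flag through a nonzero vector `x` and a plane `W` containing it admits an
adapted basis. -/
theorem exists_basis_adapted {K V : Type*} [Field K] [AddCommGroup V] [Module K V]
    (hV : Module.finrank K V = 3) {x : V} (hx : x ≠ 0) (W : Submodule K V)
    (hW : Module.finrank K W = 2) (hxW : x ∈ W) :
    ∃ B : Module.Basis (Fin 3) K V, B 0 = x ∧ ∀ a, a ∈ W ↔ B.repr a 2 = 0 := by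
  have : FiniteDimensional K V := Module.finite_of_finrank_pos (by omega)
  obtain ⟨y, hyW, hy⟩ : ∃ y ∈ W, y ∉ Submodule.span K {x} := by
    by_contra! h
    have h₁ := Submodule.finrank_mono (show W ≤ Submodule.span K {x} from h)
    rw [finrank_span_singleton hx] at h₁
    omega
  obtain ⟨z, hz⟩ : ∃ z, z ∉ W := by
    by_contra! h
    rw [(Submodule.eq_top_iff' (p := W)).2 h, finrank_top] at hW
    omega
  have li : LinearIndependent K ![x, y, z] := by
    rw [Fintype.linearIndependent_iff]
    intro g hg
    simp only [Fin.sum_univ_three, Matrix.cons_val] at hg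
    have g₂ : g 2 = 0 := by
      by_contra h
      refine hz ((W.smul_mem_iff h).1 ?_)
      rw [eq_neg_of_add_eq_zero_right hg]
      exact W.neg_mem (W.add_mem (W.smul_mem _ hxW) (W.smul_mem _ hyW))
    rw [g₂, zero_smul, add_zero] at hg
    have g₁ : g 1 = 0 := by
      by_contra h
      refine hy ((Submodule.smul_mem_iff _ h).1 ?_)
      rw [eq_neg_of_add_eq_zero_right hg]
      exact neg_mem (Submodule.smul_mem _ _ (Submodule.mem_span_singleton_self x))
    rw [g₁, zero_smul, add_zero] at hg
    have g₀ : g 0 = 0 := (smul_eq_zero.1 hg).resolve_right hx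
    intro i
    fin_cases i <;> assumption
  let B := basisOfLinearIndependentOfCardEqFinrank li (by simp [hV])
  have hB : ⇑B = ![x, y, z] := coe_basisOfLinearIndependentOfCardEqFinrank li _
  refine ⟨B, by simp [hB], fun a => ?_⟩
  have ha := B.sum_repr a
  simp only [Fin.sum_univ_three, hB, Matrix.cons_val] at ha
  have hxy : B.repr a 0 • x + B.repr a 1 • y ∈ W :=
    W.add_mem (W.smul_mem _ hxW) (W.smul_mem _ hyW)
  constructor
  · intro h
    by_contra hne
    rw [← ha, W.add_mem_iff_right hxy, W.smul_mem_iff hne] at h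
    exact hz h
  · intro h
    rw [← ha, h, zero_smul, add_zero]
    exact hxy

/-- The node-line construction: given a nonzero vector `x` of `V = (ZMod 2)³` (a point
of the Fano plane) and a two-dimensional subspace `W` of `V` containing `x` (a line
through the point), there is a knockout tournament (seeding) on the 8 players `V` in
which distinct players `a, b` can meet in round 1 iff `a + b = x`, in round 2 iff
`a + b ∈ W \ {0, x}`, and in round 3 iff `a + b ∉ W`; in particular the round in which
`a` and `b` can meet depends only on `a + b`. -/
theorem node_line_construction (x : Fin 3 → ZMod 2) (hx : x ≠ 0)
    (W : Submodule (ZMod 2) (Fin 3 → ZMod 2))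
    (hW : Module.finrank (ZMod 2) W = 2) (hxW : x ∈ W) :
    ∃ s : (Fin 3 → ZMod 2) ≃ Fin (2 ^ 3),
      ∀ a b : Fin 3 → ZMod 2, a ≠ b →
        (a + b = x → meetRound 3 s a b = 1) ∧
        (a + b ∈ W → a + b ≠ 0 → a + b ≠ x → meetRound 3 s a b = 2) ∧
        (a + b ∉ W → meetRound 3 s a b = 3) ∧
        meetRound 3 s a b = meetRound 3 s 0 (a + b) := by
  obtain ⟨B, hB, hBW⟩ := exists_basis_adapted (by simp) hx W hW hxW
  refine ⟨B.equivFun.toEquiv.trans (finFunctionFinEquiv (m := 2) (n := 3)), fun a b _ => ?_⟩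
  have hne : ∀ i, B.repr a i ≠ B.repr b i ↔ B.repr (a + b) i ≠ 0 := by
    intro i
    rw [map_add, Finsupp.add_apply, ne_eq, ne_eq, CharTwo.add_eq_zero]
  simp only [meetRound_binary, LinearEquiv.coe_toEquiv, Module.Basis.equivFun_apply, hne]
  generalize a + b = d
  refine ⟨?_, ?_, ?_, ?_⟩
  · rintro rfl
    simp [← hB]
  · intro hd h0 hdx
    have h₂ := (hBW d).1 hd
    have h₁ : B.repr d 1 ≠ 0 := by
      intro h₁
      have hd' := B.sum_repr d
      simp only [Fin.sum_univ_three, h₁, h₂, hB, zero_smul, add_zero] at hd'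
      have h01 : ∀ t : ZMod 2, t = 0 ∨ t = 1 := by decide
      rcases h01 (B.repr d 0) with h | h
      · exact h0 (by rw [← hd', h, zero_smul])
      · exact hdx (by rw [← hd', h, one_smul])
    simp [h₁, h₂]
  · intro hd
    simp [mt (hBW d).2 hd]
  · simp [eq_comm]
end

section
/- Let V = (ZMod 2)^3. Let x : Fin 7 → V and W : Fin 7 → (submodules of V) be such that x is a bijection onto the set of nonzero vectors of V, W is a bijection onto the set of two-dimensional linear subspaces of V, and x_r ∈ W_r for every r ∈ Fin 7. For each r let s_r : V ≃ Fin 8 be a seeding satisfying, for all distinct a, b ∈ V: v_{s_r}(a, b) = 1 if a + b = x_r; v_{s_r}(a, b) = 2 if a + b ∈ W_r and a + b ∉ {0, x_r}; and v_{s_r}(a, b) = 3 if a + b ∉ W_r. Then the family {s_r : r ∈ Fin 7} is a stable SKC: for every pair of distinct a, b ∈ V and every i ∈ {1, 2, 3}, the number of r ∈ Fin 7 with v_{s_r}(a, b) = i equals 2^{i−1}. -/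
/-- The plane orthogonal to a nonzero vector of `(ZMod 2)³` is two-dimensional. -/
theorem finrank_ker_dotProductEquiv_eq_two {c : Fin 3 → ZMod 2} (hc : c ≠ 0) :
    Module.finrank (ZMod 2) (LinearMap.ker (dotProductEquiv (ZMod 2) (Fin 3) c)) = 2 := by
  have h := Module.Dual.finrank_ker_add_one_of_ne_zero
    (f := dotProductEquiv (ZMod 2) (Fin 3) c) (by simpa using hc)
  rw [Module.finrank_fin_fun] at h
  omega

/-- Over `ZMod 2`, a vector is determined by its orthogonal plane. -/
theorem eq_of_forall_dotProduct_eq_zero_iff {c d : Fin 3 → ZMod 2}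
    (h : ∀ u, c ⬝ᵥ u = 0 ↔ d ⬝ᵥ u = 0) : c = d := by
  have zmod_eq : ∀ p q : ZMod 2, (p = 0 ↔ q = 0) → p = q := by decide
  exact dotProduct_eq c d fun u => zmod_eq _ _ (h u)

/-- Every point of the Fano plane lies on exactly three lines. -/
theorem card_filter_mem_eq_three (W : Fin 7 → Submodule (ZMod 2) (Fin 3 → ZMod 2))
    (hWsurj : ∀ U : Submodule (ZMod 2) (Fin 3 → ZMod 2),
      Module.finrank (ZMod 2) U = 2 → ∃ r : Fin 7, W r = U)
    {v : Fin 3 → ZMod 2} (hv : v ≠ 0) [DecidablePred fun r => v ∈ W r] :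
    (Finset.univ.filter fun r => v ∈ W r).card = 3 := by
  choose f hf using fun c : {c : Fin 3 → ZMod 2 // c ≠ 0} =>
    hWsurj _ (finrank_ker_dotProductEquiv_eq_two c.2)
  have hmem : ∀ c u, u ∈ W (f c) ↔ c.1 ⬝ᵥ u = 0 := fun c u => by
    rw [hf, LinearMap.mem_ker, dotProductEquiv_apply_apply]
  have hinj : Function.Injective f := fun c d h =>
    Subtype.ext (eq_of_forall_dotProduct_eq_zero_iff fun u => by rw [← hmem, ← hmem, h])
  have hbij : Function.Bijective f :=
    (Fintype.bijective_iff_injective_and_card f).2 ⟨hinj, by decide⟩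
  have hcount : ∀ v : Fin 3 → ZMod 2, v ≠ 0 →
      (Finset.univ.filter fun c : {c : Fin 3 → ZMod 2 // c ≠ 0} => c.1 ⬝ᵥ v = 0).card = 3 := by
    decide +kernel
  refine Eq.trans ?_ (hcount v hv)
  symm
  refine Finset.card_bij (fun c _ => f c) (fun c hc => ?_) (fun c _ d _ h => hinj h) fun r hr => ?_
  · simpa [hmem] using hc
  · obtain ⟨c, rfl⟩ := hbij.2 r
    exact ⟨c, by simpa [hmem] using hr, rfl⟩

/-- Take an enumeration `x : Fin 7 → V` of the seven nonzero vectors of `V = (ZMod 2)³`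
(the points of the Fano plane) and an enumeration `W : Fin 7 → Submodule (ZMod 2) V` of
the seven two-dimensional subspaces of `V` (the lines of the Fano plane), such that
`x r ∈ W r` for each `r`.  If `s r` is a seeding arising from the node-line pair
`(x r, W r)` (distinct players `a, b` can meet in round 1 iff `a + b = x r`, in round 2
iff `a + b ∈ W r \ {0, x r}`, and in round 3 iff `a + b ∉ W r`), then the family
`{s r : r ∈ Fin 7}` is a stable SKC on the 8 players `V`. -/
theorem fano_stable_SKC (x : Fin 7 → (Fin 3 → ZMod 2))
    (W : Fin 7 → Submodule (ZMod 2) (Fin 3 → ZMod 2))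
    (hxinj : Function.Injective x) (hx0 : ∀ r : Fin 7, x r ≠ 0)
    (hxsurj : ∀ v : Fin 3 → ZMod 2, v ≠ 0 → ∃ r : Fin 7, x r = v)
    (hWinj : Function.Injective W)
    (hWrank : ∀ r : Fin 7, Module.finrank (ZMod 2) (W r) = 2)
    (hWsurj : ∀ U : Submodule (ZMod 2) (Fin 3 → ZMod 2),
      Module.finrank (ZMod 2) U = 2 → ∃ r : Fin 7, W r = U)
    (hxW : ∀ r : Fin 7, x r ∈ W r)
    (s : Fin 7 → ((Fin 3 → ZMod 2) ≃ Fin (2 ^ 3)))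
    (hs : ∀ r : Fin 7, ∀ a b : Fin 3 → ZMod 2, a ≠ b →
      (a + b = x r → meetRound 3 (s r) a b = 1) ∧
      (a + b ∈ W r → a + b ≠ 0 → a + b ≠ x r → meetRound 3 (s r) a b = 2) ∧
      (a + b ∉ W r → meetRound 3 (s r) a b = 3)) :
    ∀ a b : Fin 3 → ZMod 2, a ≠ b → ∀ i : ℕ, 1 ≤ i → i ≤ 3 →
      (Finset.univ.filter fun r : Fin 7 =>
        meetRound 3 (s r) a b = i).card = 2 ^ (i - 1) := by
  classical
  intro a b hab i hi1 hi3
  have hv : a + b ≠ 0 := fun h => hab (by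
    rw [← sub_eq_zero, CharTwo.sub_eq_add]; exact h)
  have hlines := card_filter_mem_eq_three W hWsurj hv
  obtain ⟨r₀, hr₀⟩ := hxsurj _ hv
  have key : ∀ r, meetRound 3 (s r) a b = if r = r₀ then 1 else if a + b ∈ W r then 2 else 3 := by
    intro r
    obtain ⟨h1, h2, h3⟩ := hs r a b hab
    split_ifs with h h'
    · exact h1 (by rw [h, hr₀])
    · exact h2 h' hv fun e => h (hxinj (by rw [hr₀, e]))
    · exact h3 h'
  have hmem : a + b ∈ W r₀ := hr₀ ▸ hxW r₀
  interval_cases i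
  · have : (Finset.univ.filter fun r : Fin 7 => meetRound 3 (s r) a b = 1) = {r₀} := by
      ext r
      simp only [key, Finset.mem_filter, Finset.mem_univ, true_and, Finset.mem_singleton]
      split_ifs <;> simp_all
    simp [this]
  · have : (Finset.univ.filter fun r : Fin 7 => meetRound 3 (s r) a b = 2) =
        (Finset.univ.filter fun r => a + b ∈ W r).erase r₀ := by
      ext r
      simp only [key, Finset.mem_filter, Finset.mem_univ, true_and, Finset.mem_erase]
      split_ifs <;> simp_all
    rw [this, Finset.card_erase_of_mem (by simpa using hmem), hlines]
    norm_num
  · have : (Finset.univ.filter fun r : Fin 7 => meetRound 3 (s r) a b = 3) =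
        (Finset.univ.filter fun r => a + b ∈ W r)ᶜ := by
      ext r
      simp only [key, Finset.mem_filter, Finset.mem_univ, true_and, Finset.mem_compl]
      split_ifs <;> simp_all
    rw [this, Finset.card_compl, hlines]
    norm_num
end
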